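/- Let (E_n) be a sequence of sets of finite perimeter in R^d converging locally to a set E with 0 < |E| < liminf_n |E_n|. Then there exists a sequence of radii r_n ∈ (0,∞) such that, setting F_n := E_n ∩ B_{r_n} and G_n := E_n \ closure(B_{r_n}), one has Per(E_n) − Per(F_n) − Per(G_n) → 0, F_n → E globally, and G_n → ∅ locally. -/

import Mathlib

open MeasureTheory Filter Metric Set Topology

noncomputable section

/-- De Giorgi perimeter: the set of values `∫_E div F` over admissible vector fields. -/
def perSet (d : ℕ) (E : Set (EuclideanSpace ℝ (Fin d))) : Set ℝ :=
  {p | ∃ F : EuclideanSpace ℝ (Fin d) → EuclideanSpace ℝ (Fin d),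
      ContDiff ℝ 1 F ∧ HasCompactSupport F ∧ (∀ x, ‖F x‖ ≤ 1) ∧
      p = ∫ x in E, ∑ i, fderiv ℝ F x (EuclideanSpace.single i (1:ℝ)) i}

/-- De Giorgi perimeter of a measurable set. -/
def perimeter (d : ℕ) (E : Set (EuclideanSpace ℝ (Fin d))) : ℝ := sSup (perSet d E)

/-- A set has finite perimeter if the defining supremum is finite. -/
def FinitePerimeter (d : ℕ) (E : Set (EuclideanSpace ℝ (Fin d))) : Prop := BddAbove (perSet d E)

/-- Riesz interaction energy. -/
def riesz (d : ℕ) (l : ℝ) (A : Set (EuclideanSpace ℝ (Fin d))) : ℝ :=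
  (1/2) * ∫ x in A, ∫ y in A, ‖x - y‖ ^ (-l)

abbrev E3 := EuclideanSpace ℝ (Fin 3)

/-- Coulomb self-energy in dimension 3. -/
def coulomb (Ω : Set E3) : ℝ := (1/2) * ∫ x in Ω, ∫ y in Ω, ‖x - y‖⁻¹

/-- Liquid drop energy. -/
def ldEnergy (Ω : Set E3) : ℝ := perimeter 3 Ω + coulomb Ω

/-- Minimal liquid drop energy at mass `A`. -/
def ldE (A : ℝ) : ℝ :=
  sInf {e | ∃ Ω : Set E3, MeasurableSet Ω ∧ FinitePerimeter 3 Ω ∧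
      volume Ω = ENNReal.ofReal A ∧ e = ldEnergy Ω}



/-- The divergence of a vector field on Euclidean space. -/
def divergence {d : ℕ} (F : EuclideanSpace ℝ (Fin d) → EuclideanSpace ℝ (Fin d))
    (x : EuclideanSpace ℝ (Fin d)) : ℝ :=
  ∑ i, fderiv ℝ F x (EuclideanSpace.single i (1 : ℝ)) i

/-- The admissible vector fields in the definition of the perimeter. -/
structure IsTestField {d : ℕ}
    (F : EuclideanSpace ℝ (Fin d) → EuclideanSpace ℝ (Fin d)) : Prop where
  contDiff : ContDiff ℝ 1 F
  hasCompactSupport : HasCompactSupport F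
  norm_le_one : ∀ x, ‖F x‖ ≤ 1

section divergence

variable {d : ℕ} {X Y : EuclideanSpace ℝ (Fin d) → EuclideanSpace ℝ (Fin d)}

lemma continuous_divergence (hX : IsTestField X) : Continuous (divergence X) := by
  have := hX.contDiff.continuous_fderiv one_ne_zero
  unfold divergence
  fun_prop

lemma integrable_divergence (hX : IsTestField X) : Integrable (divergence X) := by
  refine (continuous_divergence hX).integrable_of_hasCompactSupport ?_
  refine (hX.hasCompactSupport.fderiv (𝕜 := ℝ)).mono ?_
  intro x hx h
  apply hx
  simp [divergence, h]

lemma isTestField_zero : IsTestField (0 : EuclideanSpace ℝ (Fin d) → EuclideanSpace ℝ (Fin d)) :=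
  ⟨contDiff_const, HasCompactSupport.zero, fun x => by simp⟩

lemma divergence_interpolate (hX : IsTestField X) (hY : IsTestField Y)
    {s : EuclideanSpace ℝ (Fin d) → ℝ} (hs : ContDiff ℝ 1 s) (x : EuclideanSpace ℝ (Fin d)) :
    divergence (fun x => (1 - s x) • X x + s x • Y x) x =
      (1 - s x) * divergence X x + s x * divergence Y x + fderiv ℝ s x (Y x - X x) := by
  have dX := (hX.contDiff.differentiable one_ne_zero x).hasFDerivAt
  have dY := (hY.contDiff.differentiable one_ne_zero x).hasFDerivAt
  have ds := (hs.differentiable one_ne_zero x).hasFDerivAt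
  have hw : fderiv ℝ s x (Y x - X x) =
      ∑ i, (Y x - X x) i * fderiv ℝ s x (EuclideanSpace.single i 1) := by
    conv_lhs => rw [← (EuclideanSpace.basisFun (Fin d) ℝ).sum_repr (Y x - X x)]
    simp [map_sum]
  have hZ := ((ds.const_sub 1).smul dX).add (ds.smul dY)
  rw [hw]
  unfold divergence
  erw [hZ.fderiv]
  rw [Finset.mul_sum, Finset.mul_sum, ← Finset.sum_add_distrib, ← Finset.sum_add_distrib]
  refine Finset.sum_congr rfl fun i _ => ?_
  simp
  ring

lemma IsTestField.interpolate (hX : IsTestField X) (hY : IsTestField Y)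
    {s : EuclideanSpace ℝ (Fin d) → ℝ} (hs : ContDiff ℝ 1 s) (hs01 : ∀ x, s x ∈ Icc (0 : ℝ) 1) :
    IsTestField (fun x => (1 - s x) • X x + s x • Y x) where
  contDiff := by
    have := hX.contDiff
    have := hY.contDiff
    fun_prop
  hasCompactSupport :=
    (hX.hasCompactSupport.smul_left (f := fun x => 1 - s x)).add
      (hY.hasCompactSupport.smul_left (f := s))
  norm_le_one x := by
    have hb := convex_closedBall (0 : EuclideanSpace ℝ (Fin d)) 1
    simpa using hb (x := X x) (by simpa using hX.norm_le_one x) (y := Y x)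
      (by simpa using hY.norm_le_one x) (sub_nonneg.2 (hs01 x).2) (hs01 x).1 (by ring)

end divergence

section perimeter

variable {d : ℕ} {E : Set (EuclideanSpace ℝ (Fin d))}

lemma integral_divergence_mem_perSet {X : EuclideanSpace ℝ (Fin d) → EuclideanSpace ℝ (Fin d)}
    (hX : IsTestField X) : ∫ x in E, divergence X x ∈ perSet d E :=
  ⟨X, hX.contDiff, hX.hasCompactSupport, hX.norm_le_one, rfl⟩

lemma zero_mem_perSet : (0 : ℝ) ∈ perSet d E := by
  simpa [divergence] using integral_divergence_mem_perSet (E := E) isTestField_zero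

lemma exists_isTestField_of_mem_perSet {p : ℝ} (hp : p ∈ perSet d E) :
    ∃ X, IsTestField X ∧ p = ∫ x in E, divergence X x := by
  obtain ⟨X, h1, h2, h3, h4⟩ := hp
  exact ⟨X, ⟨h1, h2, h3⟩, h4⟩

end perimeter

/-- The half-open spherical shell of points whose squared norm lies in `Ioc a b`. -/
def shell (d : ℕ) (a b : ℝ) : Set (EuclideanSpace ℝ (Fin d)) := {x | ‖x‖ ^ 2 ∈ Ioc a b}

lemma measurableSet_shell (d : ℕ) (a b : ℝ) : MeasurableSet (shell d a b) :=
  measurableSet_Ioc.preimage (by fun_prop)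

lemma shell_subset_closedBall {d : ℕ} {a R : ℝ} (hR : 0 ≤ R) :
    shell d a (R ^ 2) ⊆ closedBall 0 R := fun _ hx =>
  mem_closedBall_zero_iff.2 (le_of_sq_le_sq hx.2 hR)

/-- A smooth radial function equal to `0` where `‖x‖ ^ 2 ≤ a` and to `1` where
`a + h ≤ ‖x‖ ^ 2`. -/
def radialStep {d : ℕ} (a h : ℝ) (x : EuclideanSpace ℝ (Fin d)) : ℝ :=
  Real.smoothTransition ((‖x‖ ^ 2 - a) / h)

lemma exists_deriv_smoothTransition_bound :
    ∃ C : ℝ, 0 ≤ C ∧ ∀ u, |deriv Real.smoothTransition u| ≤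
      (Ioc (0 : ℝ) 1).indicator (fun _ => C) u := by
  have hc : Continuous (deriv Real.smoothTransition) :=
    (Real.smoothTransition.contDiff (n := 1)).continuous_deriv le_rfl
  obtain ⟨C, hC⟩ := isCompact_Icc (a := (0 : ℝ)) (b := 1) |>.exists_bound_of_continuousOn
    hc.continuousOn
  refine ⟨C, (norm_nonneg _).trans (hC 0 (by simp)), fun u => ?_⟩
  by_cases hu : u ∈ Ioc (0 : ℝ) 1
  · rw [indicator_of_mem hu]
    exact hC u (Ioc_subset_Icc_self hu)
  · rw [indicator_of_notMem hu]
    simp only [mem_Ioc, not_and_or, not_lt, not_le] at hu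
    rcases hu with hu | hu
    · rw [IsLocalMin.deriv_eq_zero (Eventually.of_forall fun y => ?_)]
      · simp
      · rw [Real.smoothTransition.zero_of_nonpos hu]
        exact Real.smoothTransition.nonneg y
    · rw [IsLocalMax.deriv_eq_zero (Eventually.of_forall fun y => ?_)]
      · simp
      · rw [Real.smoothTransition.one_of_one_le hu.le]
        exact Real.smoothTransition.le_one y

lemma contDiff_radialStep {d : ℕ} (a h : ℝ) :
    ContDiff ℝ 1 (radialStep a h : EuclideanSpace ℝ (Fin d) → ℝ) :=
  Real.smoothTransition.contDiff.comp
    (((contDiff_norm_sq ℝ).sub contDiff_const).div_const h)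

lemma radialStep_mem_Icc {d : ℕ} (a h : ℝ) (x : EuclideanSpace ℝ (Fin d)) :
    radialStep a h x ∈ Icc (0 : ℝ) 1 :=
  ⟨Real.smoothTransition.nonneg _, Real.smoothTransition.le_one _⟩

lemma norm_fderiv_radialStep_le {d : ℕ} {C : ℝ}
    (hC : ∀ u, |deriv Real.smoothTransition u| ≤ (Ioc (0 : ℝ) 1).indicator (fun _ => C) u)
    {a h R : ℝ} (hh : 0 < h) (hR : 0 ≤ R) (hahR : a + h ≤ R ^ 2) (x : EuclideanSpace ℝ (Fin d)) :
    ‖fderiv ℝ (radialStep a h) x‖ ≤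
      (shell d a (a + h)).indicator (fun _ => 2 * C * R / h) x := by
  have h1 : HasFDerivAt (fun y : EuclideanSpace ℝ (Fin d) => (‖y‖ ^ 2 - a) / h)
      (h⁻¹ • ((2 : ℝ) • innerSL ℝ x)) x := by
    simpa [div_eq_inv_mul, ← Nat.cast_smul_eq_nsmul ℝ] using
      (((hasStrictFDerivAt_norm_sq x).hasFDerivAt).sub_const a).const_mul h⁻¹
  have h2 := ((Real.smoothTransition.contDiff (n := 1)).differentiable one_ne_zero
    ((‖x‖ ^ 2 - a) / h)).hasDerivAt.comp_hasFDerivAt x h1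
  have h3 : fderiv ℝ (radialStep a h) x = _ := h2.fderiv
  rw [h3, norm_smul, norm_smul, norm_smul, innerSL_apply_norm, Real.norm_eq_abs]
  have hu := hC ((‖x‖ ^ 2 - a) / h)
  have hiff : (‖x‖ ^ 2 - a) / h ∈ Ioc (0 : ℝ) 1 ↔ ‖x‖ ^ 2 ∈ Ioc a (a + h) := by
    rw [mem_Ioc, mem_Ioc, div_pos_iff_of_pos_right hh, div_le_one hh]
    constructor <;> rintro ⟨_, _⟩ <;> constructor <;> linarith
  by_cases hx : ‖x‖ ^ 2 ∈ Ioc a (a + h)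
  · rw [indicator_of_mem (hiff.2 hx)] at hu
    rw [indicator_of_mem (show x ∈ (shell d a (a + h)) from hx)]
    have hxR : ‖x‖ ≤ R := le_of_sq_le_sq (hx.2.trans hahR) hR
    have hC0 : 0 ≤ C := (abs_nonneg _).trans hu
    rw [norm_inv, Real.norm_eq_abs, abs_of_pos hh, Real.norm_two]
    calc _ ≤ C * (h⁻¹ * (2 * R)) := by gcongr
      _ = _ := by field_simp
  · rw [indicator_of_notMem (mt hiff.1 hx)] at hu
    rw [indicator_of_notMem (show x ∉ (shell d a (a + h)) from hx)]
    rw [le_antisymm hu (abs_nonneg _), zero_mul]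

/-- Testing the perimeter of `E` with a field interpolating from `X` to `Y` across a shell. -/
lemma integral_interpolate_le_perimeter {d : ℕ} {E : Set (EuclideanSpace ℝ (Fin d))}
    (hfp : FinitePerimeter d E) {X Y : EuclideanSpace ℝ (Fin d) → EuclideanSpace ℝ (Fin d)}
    (hX : IsTestField X) (hY : IsTestField Y) {C : ℝ}
    (hC : ∀ u, |deriv Real.smoothTransition u| ≤ (Ioc (0 : ℝ) 1).indicator (fun _ => C) u)
    {a h R : ℝ} (hh : 0 < h) (hR : 0 ≤ R) (hahR : a + h ≤ R ^ 2) :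
    ∫ x in E, ((1 - radialStep a h x) * divergence X x + radialStep a h x * divergence Y x) ≤
      perimeter d E + 4 * C * R / h * volume.real (E ∩ shell d a (a + h)) := by
  have hs := contDiff_radialStep (d := d) a h
  have hZ := hX.interpolate hY hs (radialStep_mem_Icc a h)
  have hle := le_csSup hfp (integral_divergence_mem_perSet (E := E) hZ)
  have hsplit := funext (divergence_interpolate hX hY hs)
  have hiX : Integrable (fun x => (1 - radialStep a h x) * divergence X x) := by
    refine (integrable_divergence hX).bdd_mul (c := 1)
      (by have := hs.continuous; fun_prop) (Eventually.of_forall fun x => ?_)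
    have := radialStep_mem_Icc a h x
    rw [Real.norm_eq_abs, abs_le]
    constructor <;> linarith [this.1, this.2]
  have hiY : Integrable (fun x => radialStep a h x * divergence Y x) := by
    refine (integrable_divergence hY).bdd_mul (c := 1)
      (by have := hs.continuous; fun_prop) (Eventually.of_forall fun x => ?_)
    have := radialStep_mem_Icc a h x
    rw [Real.norm_eq_abs, abs_le]
    constructor <;> linarith [this.1, this.2]
  have hiD : Integrable (fun x => fderiv ℝ (radialStep a h) x (Y x - X x)) := by
    refine ((integrable_divergence hZ).sub (hiX.add hiY)).congr (Eventually.of_forall fun x => ?_)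
    simp [hsplit]
  have hiXY : Integrable (fun x => (1 - radialStep a h x) * divergence X x +
      radialStep a h x * divergence Y x) := hiX.add hiY
  rw [hsplit] at hle
  beta_reduce at hle
  rw [integral_add hiXY.integrableOn hiD.integrableOn] at hle
  have hD : ‖∫ x in E, fderiv ℝ (radialStep a h) x (Y x - X x)‖ ≤
      ∫ x in E, (shell d a (a + h)).indicator (fun _ => 4 * C * R / h) x := by
    have hsub : shell d a (a + h) ⊆ closedBall 0 R := fun x hx =>
      shell_subset_closedBall (a := a) hR ⟨hx.1, hx.2.trans hahR⟩
    have hsh : volume (shell d a (a + h)) ≠ ⊤ :=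
      ((measure_mono hsub).trans_lt measure_closedBall_lt_top).ne
    refine norm_integral_le_of_norm_le (IntegrableOn.integrable_indicator
      (integrableOn_const hsh) (measurableSet_shell d _ _)).integrableOn
      (Eventually.of_forall fun x => ?_)
    refine (ContinuousLinearMap.le_opNorm _ _).trans ?_
    have h1 := norm_fderiv_radialStep_le hC hh hR hahR x
    have h2 : ‖Y x - X x‖ ≤ 2 := (norm_sub_le _ _).trans (by
      linarith [hX.norm_le_one x, hY.norm_le_one x])
    refine (mul_le_mul h1 h2 (norm_nonneg _) ((norm_nonneg _).trans h1)).trans (le_of_eq ?_)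
    by_cases hx : x ∈ shell d a (a + h)
    · simp only [indicator_of_mem hx]; ring
    · simp only [indicator_of_notMem hx]; ring
  rw [integral_indicator_const _ (measurableSet_shell d _ _),
    measureReal_restrict_apply (measurableSet_shell d _ _), inter_comm, smul_eq_mul] at hD
  have := neg_le_of_abs_le hD
  change _ ≤ perimeter d E at hle
  linarith

/-- Among `k + 1` consecutive intervals of equal length, some interval carries at most the average
increment of `g`. -/
lemma exists_small_increment (g : ℝ → ℝ) {a b : ℝ} (hab : a ≤ b) (k : ℕ) :
    ∃ t ∈ Icc a b, t + (b - a) / (k + 1) ≤ b ∧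
      g (t + (b - a) / (k + 1)) - g t ≤ (g b - g a) / (k + 1) := by
  have hk : (0 : ℝ) < k + 1 := by positivity
  set h := (b - a) / (k + 1) with hdef
  have hh : 0 ≤ h := div_nonneg (sub_nonneg.2 hab) hk.le
  have hkh : (k + 1) * h = b - a := by rw [hdef]; field_simp
  have hsum : ∑ i ∈ Finset.range (k + 1), (g (a + (i + 1 : ℕ) * h) - g (a + (i : ℕ) * h)) ≤
      ∑ _i ∈ Finset.range (k + 1), (g b - g a) / (k + 1) := by
    rw [Finset.sum_range_sub (fun i : ℕ => g (a + i * h))]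
    rw [Finset.sum_const, Finset.card_range, nsmul_eq_mul]
    push_cast
    rw [hkh, mul_div_cancel₀ _ hk.ne']
    simp
  obtain ⟨i, hi, hle⟩ := Finset.exists_le_of_sum_le (by simp) hsum
  have hi' : (i : ℝ) + 1 ≤ k + 1 := by exact_mod_cast Finset.mem_range.1 hi
  have hb : a + i * h + h ≤ b := by nlinarith
  have heq : a + i * h + h = a + (i + 1 : ℕ) * h := by push_cast; ring
  refine ⟨a + i * h, ⟨by nlinarith [mul_nonneg (Nat.cast_nonneg (α := ℝ) i) hh], by linarith⟩, hb, ?_⟩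
  rwa [heq]

lemma exists_sum_integral_divergence_le {d : ℕ} {E : Set (EuclideanSpace ℝ (Fin d))}
    (hE : MeasurableSet E) (hfp : FinitePerimeter d E) {C : ℝ} (hC0 : 0 ≤ C)
    (hC : ∀ u, |deriv Real.smoothTransition u| ≤ (Ioc (0 : ℝ) 1).indicator (fun _ => C) u)
    {R : ℝ} (hR : 0 < R) :
    ∃ r ∈ Icc (R / 2) R, ∀ X Y, IsTestField X → IsTestField Y →
      (∫ x in E ∩ ball 0 r, divergence X x) + ∫ x in E \ closedBall 0 r, divergence Y x ≤
        perimeter d E + 16 / 3 * C / R * volume.real (E ∩ shell d ((R / 2) ^ 2) (R ^ 2)) := by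
  set a := (R / 2) ^ 2 with ha
  set b := R ^ 2 with hb
  have hab : a < b := by rw [ha, hb]; nlinarith
  have hsh (t : ℝ) (htb : t ≤ b) : volume (E ∩ shell d (-1) t) ≠ ⊤ :=
    ((measure_mono fun x hx => shell_subset_closedBall (a := -1) hR.le
      ⟨hx.2.1, hx.2.2.trans htb⟩).trans_lt measure_closedBall_lt_top).ne
  have hdiff (s t : ℝ) (hs : -1 ≤ s) (hst : s ≤ t) (htb : t ≤ b) :
      volume.real (E ∩ shell d s t) =
        volume.real (E ∩ shell d (-1) t) - volume.real (E ∩ shell d (-1) s) := by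
    have hsub : E ∩ shell d (-1) s ⊆ E ∩ shell d (-1) t := fun x hx =>
      ⟨hx.1, hx.2.1, hx.2.2.trans hst⟩
    rw [← measureReal_sdiff hsub (hE.inter (measurableSet_shell d _ _)) (hsh t htb)]
    congr 1
    ext x
    simp only [shell, mem_inter_iff, mem_ofPred_eq, mem_Ioc, Set.mem_sdiff]
    grind
  have ha0 : 0 < a := by positivity
  choose t htab htb hinc using
    exists_small_increment (fun t => volume.real (E ∩ shell d (-1) t)) hab.le
  obtain ⟨T, hT, φ, hφ, hlim⟩ := isCompact_Icc.tendsto_subseq htab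
  have hT0 : 0 < T := ha0.trans_le hT.1
  have hh : Tendsto (fun k => (b - a) / ((φ k : ℝ) + 1)) atTop (𝓝 0) := by
    have := (tendsto_const_div_atTop_nhds_zero_nat (b - a)).comp
      ((tendsto_add_atTop_nat 1).comp hφ.tendsto_atTop)
    refine this.congr fun k => ?_
    simp
  refine ⟨√T, ⟨Real.le_sqrt_of_sq_le hT.1, Real.sqrt_le_iff.2 ⟨hR.le, hT.2⟩⟩, fun X Y hX hY => ?_⟩
  have hconv : Tendsto (fun k => ∫ x in E,
      ((1 - radialStep (t (φ k)) ((b - a) / ((φ k : ℝ) + 1)) x) * divergence X x +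
        radialStep (t (φ k)) ((b - a) / ((φ k : ℝ) + 1)) x * divergence Y x)) atTop
      (𝓝 (∫ x in E, ((ball 0 √T).indicator (divergence X) x +
        (closedBall 0 √T)ᶜ.indicator (divergence Y) x))) := by
    refine tendsto_integral_of_dominated_convergence
      (fun x => ‖divergence X x‖ + ‖divergence Y x‖) (fun k => ?_)
      ((integrable_divergence hX).norm.add (integrable_divergence hY).norm).integrableOn
      (fun k => Eventually.of_forall fun x => ?_) (ae_restrict_of_ae ?_)
    · have h1 := (contDiff_radialStep (d := d) (t (φ k)) ((b - a) / ((φ k : ℝ) + 1))).continuous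
      have h2 := continuous_divergence hX
      have h3 := continuous_divergence hY
      exact Continuous.aestronglyMeasurable (by fun_prop)
    · have := radialStep_mem_Icc (t (φ k)) ((b - a) / ((φ k : ℝ) + 1)) x
      refine (norm_add_le _ _).trans ?_
      rw [norm_mul, norm_mul, Real.norm_eq_abs, Real.norm_eq_abs (radialStep _ _ _),
        abs_of_nonneg this.1, abs_of_nonneg (sub_nonneg.2 this.2)]
      exact add_le_add (mul_le_of_le_one_left (norm_nonneg _) (by linarith [this.1]))
        (mul_le_of_le_one_left (norm_nonneg _) this.2)
    · have hnull : volume (sphere (0 : EuclideanSpace ℝ (Fin d)) √T) = 0 :=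
        Measure.addHaar_sphere_of_ne_zero _ _ (Real.sqrt_pos.2 hT0).ne'
      filter_upwards [measure_eq_zero_iff_ae_notMem.1 hnull] with x hx
      rw [mem_sphere_zero_iff_norm] at hx
      rcases lt_or_gt_of_ne hx with hx | hx
      · rw [indicator_of_mem (by simpa using hx), indicator_of_notMem (by simpa using hx.le)]
        have hxT : ‖x‖ ^ 2 < T := (Real.lt_sqrt (norm_nonneg _)).1 hx
        refine tendsto_const_nhds.congr' ?_
        filter_upwards [hlim.eventually_const_lt hxT] with k hk
        have : radialStep (t (φ k)) ((b - a) / ((φ k : ℝ) + 1)) x = 0 :=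
          Real.smoothTransition.zero_of_nonpos (div_nonpos_of_nonpos_of_nonneg
            (sub_nonpos.2 hk.le) (div_nonneg (sub_nonneg.2 hab.le) (by positivity)))
        simp [this]
      · rw [indicator_of_notMem (by simpa using hx.le), indicator_of_mem (by simpa using hx)]
        have hxT : T + 0 < ‖x‖ ^ 2 := by
          rw [add_zero]; exact (Real.sqrt_lt' ((Real.sqrt_nonneg _).trans_lt hx)).1 hx
        refine tendsto_const_nhds.congr' ?_
        filter_upwards [(hlim.add hh).eventually_lt_const hxT] with k hk
        have : radialStep (t (φ k)) ((b - a) / ((φ k : ℝ) + 1)) x = 1 :=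
          Real.smoothTransition.one_of_one_le ((one_le_div
            (div_pos (sub_pos.2 hab) (by positivity))).2 (by
              simp only [Function.comp_apply] at hk; linarith))
        simp [this]
  rw [integral_add ((integrable_divergence hX).indicator measurableSet_ball).integrableOn
    ((integrable_divergence hY).indicator measurableSet_closedBall.compl).integrableOn,
    setIntegral_indicator measurableSet_ball,
    setIntegral_indicator measurableSet_closedBall.compl, ← Set.sdiff_eq] at hconv
  refine le_of_tendsto' hconv fun k => ?_
  have hk : (0 : ℝ) < (φ k : ℝ) + 1 := by positivity
  have hhk : 0 < (b - a) / ((φ k : ℝ) + 1) := div_pos (sub_pos.2 hab) hk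
  refine (integral_interpolate_le_perimeter hfp hX hY hC hhk hR.le (htb (φ k))).trans ?_
  have ht1 : -1 ≤ t (φ k) := by linarith [(htab (φ k)).1]
  rw [hdiff _ _ ht1 (by linarith) (htb (φ k)), hdiff a b (by linarith) hab.le le_rfl]
  have h1 := hinc (φ k)
  refine add_le_add le_rfl ?_
  refine (mul_le_mul_of_nonneg_left h1 (by positivity)).trans (le_of_eq ?_)
  have hba : b - a = 3 / 4 * R ^ 2 := by rw [ha, hb]; ring
  rw [hba]
  field_simp
  ring

/-- A set of finite perimeter can be cut along a sphere of radius between `R / 2` and `R` with the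
perimeter defect controlled by the mass in the corresponding shell, divided by `R`. -/
lemma exists_abs_perimeter_sub_le {d : ℕ} {E : Set (EuclideanSpace ℝ (Fin d))}
    (hE : MeasurableSet E) (hfp : FinitePerimeter d E) {C : ℝ} (hC0 : 0 ≤ C)
    (hC : ∀ u, |deriv Real.smoothTransition u| ≤ (Ioc (0 : ℝ) 1).indicator (fun _ => C) u)
    {R : ℝ} (hR : 0 < R) :
    ∃ r ∈ Icc (R / 2) R,
      |perimeter d E - perimeter d (E ∩ ball 0 r) - perimeter d (E \ closedBall 0 r)| ≤
        16 / 3 * C / R * volume.real (E ∩ shell d ((R / 2) ^ 2) (R ^ 2)) := by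
  obtain ⟨r, hr, hle⟩ := exists_sum_integral_divergence_le hE hfp hC0 hC hR
  refine ⟨r, hr, ?_⟩
  set M := 16 / 3 * C / R * volume.real (E ∩ shell d ((R / 2) ^ 2) (R ^ 2))
  have hM0 : 0 ≤ M := by positivity
  have hle' : ∀ p ∈ perSet d (E ∩ ball 0 r), ∀ q ∈ perSet d (E \ closedBall 0 r),
      p + q ≤ perimeter d E + M := by
    intro p hp q hq
    obtain ⟨X, hX, rfl⟩ := exists_isTestField_of_mem_perSet hp
    obtain ⟨Y, hY, rfl⟩ := exists_isTestField_of_mem_perSet hq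
    exact hle X Y hX hY
  have hF : FinitePerimeter d (E ∩ ball 0 r) :=
    ⟨_, fun p hp => by simpa using hle' p hp 0 zero_mem_perSet⟩
  have hG : FinitePerimeter d (E \ closedBall 0 r) :=
    ⟨_, fun q hq => by simpa using hle' 0 zero_mem_perSet q hq⟩
  have hupper : perimeter d (E ∩ ball 0 r) + perimeter d (E \ closedBall 0 r) ≤
      perimeter d E + M := by
    rw [← le_sub_iff_add_le]
    refine csSup_le ⟨0, zero_mem_perSet⟩ fun p hp => ?_
    rw [le_sub_comm]
    refine csSup_le ⟨0, zero_mem_perSet⟩ fun q hq => ?_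
    linarith [hle' p hp q hq]
  have hlower : perimeter d E ≤
      perimeter d (E ∩ ball 0 r) + perimeter d (E \ closedBall 0 r) := by
    refine csSup_le ⟨0, zero_mem_perSet⟩ fun p hp => ?_
    obtain ⟨X, hX, rfl⟩ := exists_isTestField_of_mem_perSet hp
    have hdisj : Disjoint (E ∩ ball 0 r) (E \ closedBall 0 r) :=
      disjoint_sdiff_right.mono_left (inter_subset_right.trans ball_subset_closedBall)
    have hae : E =ᵐ[volume] (E ∩ ball 0 r ∪ E \ closedBall 0 r : Set _) := by
      have hnull : volume (sphere (0 : EuclideanSpace ℝ (Fin d)) r) = 0 :=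
        Measure.addHaar_sphere_of_ne_zero _ _ (by linarith [hr.1])
      filter_upwards [measure_eq_zero_iff_ae_notMem.1 hnull] with x hx
      rw [mem_sphere_zero_iff_norm] at hx
      have : ‖x‖ < r ∨ r < ‖x‖ := lt_or_gt_of_ne hx
      refine propext (?_ : x ∈ E ↔ x ∈ E ∩ ball 0 r ∪ E \ closedBall 0 r)
      simp only [mem_union, mem_inter_iff, Set.mem_sdiff, mem_ball_zero_iff, mem_closedBall_zero_iff,
        not_le]
      tauto
    rw [setIntegral_congr_set hae, setIntegral_union hdisj
      (hE.diff measurableSet_closedBall) (integrable_divergence hX).integrableOn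
      (integrable_divergence hX).integrableOn]
    exact add_le_add (le_csSup hF (integral_divergence_mem_perSet hX))
      (le_csSup hG (integral_divergence_mem_perSet hX))
  rw [abs_le]
  constructor <;> linarith

lemma exists_tendsto_atTop_of_forall_tendsto_zero {f : ℕ → ℝ → ENNReal}
    (hf : ∀ R, Tendsto (fun n => f n R) atTop (𝓝 0)) :
    ∃ R : ℕ → ℝ, (∀ n, 1 ≤ R n) ∧ Tendsto R atTop atTop ∧
      Tendsto (fun n => f n (R n)) atTop (𝓝 0) := by
  classical
  set N : ℕ → ℕ := fun n => Nat.findGreatest (fun j => f n j ≤ (j : ENNReal)⁻¹) n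
  have hN : Tendsto N atTop atTop := by
    refine tendsto_atTop.2 fun j => ?_
    have hj : (0 : ENNReal) < (j : ENNReal)⁻¹ := ENNReal.inv_pos.2 (ENNReal.natCast_ne_top j)
    filter_upwards [(hf j).eventually_le_const hj, eventually_ge_atTop j] with n hn hjn
    exact Nat.le_findGreatest hjn hn
  have hev : ∀ᶠ n in atTop, 1 ≤ N n := hN.eventually_ge_atTop 1
  have hRN : ∀ᶠ n in atTop, max (N n : ℝ) 1 = N n :=
    hev.mono fun n hn => max_eq_left (by exact_mod_cast hn)
  refine ⟨fun n => max (N n) 1, fun n => le_max_right _ _,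
    (tendsto_natCast_atTop_atTop.comp hN).congr' (hRN.mono fun n hn => hn.symm), ?_⟩
  refine tendsto_of_tendsto_of_tendsto_of_le_of_le' tendsto_const_nhds
    (ENNReal.tendsto_inv_nat_nhds_zero.comp hN) (Eventually.of_forall fun n => zero_le) ?_
  filter_upwards [hev, hRN] with n hn hR
  rw [hR]
  exact Nat.findGreatest_of_ne_zero (P := fun j : ℕ => f n j ≤ (j : ENNReal)⁻¹) (n := n) rfl
    (Nat.one_le_iff_ne_zero.1 hn)

lemma tendsto_measure_diff_ball {d : ℕ} {A : Set (EuclideanSpace ℝ (Fin d))}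
    (hA : MeasurableSet A) (hfin : volume A ≠ ⊤) :
    Tendsto (fun r : ℝ => volume (A \ ball 0 r)) atTop (𝓝 0) := by
  have h := tendsto_measure_iInter_atTop (μ := volume) (s := fun r : ℝ => A \ ball 0 r)
    (fun r => (hA.diff measurableSet_ball).nullMeasurableSet)
    (fun r s hrs => sdiff_subset_sdiff_right (ball_subset_ball hrs))
    ⟨0, ne_top_of_le_ne_top hfin (measure_mono sdiff_subset)⟩
  have hempty : ⋂ r : ℝ, A \ ball 0 r = ∅ := by
    refine eq_empty_of_forall_notMem fun x hx => ?_
    have := (mem_iInter.1 hx (‖x‖ + 1)).2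
    simp at this
  rwa [hempty, measure_empty] at h

/-- the dichotomy decomposition into a main piece and a missing piece. -/
theorem dichotomy (d : ℕ)
    (E : ℕ → Set (EuclideanSpace ℝ (Fin d))) (Elim : Set (EuclideanSpace ℝ (Fin d)))
    (hmeas : ∀ n, MeasurableSet (E n)) (hfp : ∀ n, FinitePerimeter d (E n))
    (hml : MeasurableSet Elim)
    (hloc : ∀ K : Set (EuclideanSpace ℝ (Fin d)), IsCompact K →
      Tendsto (fun n => volume (symmDiff (E n) Elim ∩ K)) atTop (𝓝 0))
    (hpos : 0 < volume Elim)
    (hlt : volume Elim < liminf (fun n => volume (E n)) atTop) :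
    ∃ r : ℕ → ℝ, (∀ n, 0 < r n) ∧
      Tendsto (fun n => perimeter d (E n) - perimeter d (E n ∩ ball 0 (r n)) -
        perimeter d (E n \ closedBall 0 (r n))) atTop (𝓝 0) ∧
      Tendsto (fun n => volume (symmDiff (E n ∩ ball 0 (r n)) Elim)) atTop (𝓝 0) ∧
      ∀ K : Set (EuclideanSpace ℝ (Fin d)), IsCompact K →
        Tendsto (fun n => volume ((E n \ closedBall 0 (r n)) ∩ K)) atTop (𝓝 0) := by
  obtain ⟨C, hC0, hC⟩ := exists_deriv_smoothTransition_bound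
  have hfin : volume Elim ≠ ⊤ := (hlt.trans_le le_top).ne
  obtain ⟨R, hR1, hR, hsymm⟩ := exists_tendsto_atTop_of_forall_tendsto_zero
    (f := fun n R => volume (symmDiff (E n) Elim ∩ closedBall 0 R))
    fun R => hloc _ (isCompact_closedBall 0 R)
  choose r hr hper using fun n =>
    exists_abs_perimeter_sub_le (hmeas n) (hfp n) hC0 hC (zero_lt_one.trans_le (hR1 n))
  have hR2 : Tendsto (fun n => R n / 2) atTop atTop := hR.atTop_div_const two_pos
  have hrtop : Tendsto r atTop atTop := tendsto_atTop_mono (fun n => (hr n).1) hR2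
  have hsum (ρ : ℕ → ℝ) (hρ : Tendsto ρ atTop atTop) :
      Tendsto (fun n => volume (symmDiff (E n) Elim ∩ closedBall 0 (R n)) +
        volume (Elim \ ball 0 (ρ n))) atTop (𝓝 0) := by
    simpa using hsymm.add ((tendsto_measure_diff_ball hml hfin).comp hρ)
  refine ⟨r, fun n => by linarith [(hr n).1, hR1 n], ?_, ?_, fun K hK => ?_⟩
  · have hshell : Tendsto (fun n => volume (E n ∩ shell d ((R n / 2) ^ 2) (R n ^ 2))) atTop
        (𝓝 0) := by
      refine tendsto_of_tendsto_of_tendsto_of_le_of_le tendsto_const_nhds (hsum _ hR2)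
        (fun n => zero_le) fun n => (measure_mono fun x hx => ?_).trans (measure_union_le _ _)
      have hR0 : 0 ≤ R n := zero_le_one.trans (hR1 n)
      by_cases hxE : x ∈ Elim
      · refine Or.inr ⟨hxE, fun hxb => ?_⟩
        rw [mem_ball_zero_iff] at hxb
        have := hx.2.1
        nlinarith [norm_nonneg x]
      · exact Or.inl ⟨Or.inl ⟨hx.1, hxE⟩, shell_subset_closedBall hR0 hx.2⟩
    have hreal : Tendsto (fun n => 16 / 3 * C *
        volume.real (E n ∩ shell d ((R n / 2) ^ 2) (R n ^ 2))) atTop (𝓝 0) := by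
      simpa [Measure.real] using
        ((ENNReal.tendsto_toReal ENNReal.zero_ne_top).comp hshell).const_mul (16 / 3 * C)
    refine squeeze_zero_norm (fun n => (hper n).trans ?_) hreal
    gcongr
    exact div_le_self (by positivity) (hR1 n)
  · refine tendsto_of_tendsto_of_tendsto_of_le_of_le tendsto_const_nhds (hsum r hrtop)
      (fun n => zero_le) fun n => (measure_mono ?_).trans (measure_union_le _ _)
    rintro x (⟨⟨hx, hxb⟩, hxE⟩ | ⟨hxE, hx⟩)
    · exact Or.inl ⟨Or.inl ⟨hx, hxE⟩,
        closedBall_subset_closedBall (hr n).2 (ball_subset_closedBall hxb)⟩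
    · by_cases hxb : x ∈ ball 0 (r n)
      · exact Or.inl ⟨Or.inr ⟨hxE, fun h => hx ⟨h, hxb⟩⟩,
          closedBall_subset_closedBall (hr n).2 (ball_subset_closedBall hxb)⟩
      · exact Or.inr ⟨hxE, hxb⟩
  · obtain ⟨ρ, hρ⟩ := hK.isBounded.subset_closedBall 0
    refine tendsto_const_nhds.congr' ?_
    filter_upwards [hrtop.eventually_ge_atTop ρ] with n hn
    have : (E n \ closedBall 0 (r n)) ∩ K = ∅ := eq_empty_of_forall_notMem fun x hx =>
      hx.1.2 (closedBall_subset_closedBall hn (hρ hx.2))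
    rw [this, measure_empty]
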